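/- (Convergence of the randomized triple Kaczmarz algorithm.) Let A be a nonzero real m×n matrix all of whose rows A_{i,:} and columns A_{:,j} are nonzero, let b ∈ ℝᵐ and c ∈ ℝⁿ with c ∉ range(Aᵀ). Let y⁰ ∈ c + range(Aᵀ), z⁰ ∈ b + range(A), and x⁰ ∈ ℝⁿ arbitrary. Let y* be the unique vector with Ay* = 0 and y⁰ − y* ∈ range(Aᵀ), let z* be the unique vector with Aᵀz* = c − y* and z⁰ − z* ∈ range(A), and let x* be the unique vector with Ax* = b − z* and x⁰ − x* ∈ range(Aᵀ). Then for every k ≥ 1 the RTK iterates satisfy E[‖x^k − x*‖₂²] ≤ (k(k+1)ρ^k/(2‖A‖_F⁴))‖y⁰ − y*‖₂² + (kρ^k/‖A‖_F²)‖z⁰ − z*‖₂² + ρ^k‖x⁰ − x*‖₂², where the expectation is over all sequences of index triples ((l₁,j₁,i₁),…,(l_k,j_k,i_k)) ∈ ([m]×[n]×[m])^k weighted by ∏_{t=1}^{k} (‖A_{l_t,:}‖₂²/‖A‖_F²)(‖A_{:,j_t}‖₂²/‖A‖_F²)(‖A_{i_t,:}‖₂²/‖A‖_F²). -/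

import Mathlib

open Matrix

/-- Squared Euclidean norm. -/
def sqnorm {n : ℕ} (u : Fin n → ℝ) : ℝ := ∑ i, (u i) ^ 2

/-- Squared Frobenius norm of a matrix. -/
def frob2 {m n : ℕ} (A : Matrix (Fin m) (Fin n) ℝ) : ℝ := ∑ i, ∑ j, (A i j) ^ 2

/-- Squared Euclidean norm of the `i`-th row of `A`. -/
def rowNorm2 {m n : ℕ} (A : Matrix (Fin m) (Fin n) ℝ) (i : Fin m) : ℝ := ∑ j, (A i j) ^ 2

/-- Squared Euclidean norm of the `j`-th column of `A`. -/
def colNorm2 {m n : ℕ} (A : Matrix (Fin m) (Fin n) ℝ) (j : Fin n) : ℝ := ∑ i, (A i j) ^ 2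

/-- One step of the randomized triple Kaczmarz algorithm for `AᵀAx = Aᵀb − c`:
given the index triple `(l, j, i)`, update `y` by a Kaczmarz step on `Ay = 0` with row `l`,
then `z` by a Kaczmarz step on `Aᵀz = c − y` with column `j`,
then `x` by a Kaczmarz step on `Ax = b − z` with row `i`. -/
noncomputable def rtkStep {m n : ℕ} (A : Matrix (Fin m) (Fin n) ℝ) (b : Fin m → ℝ)
    (c : Fin n → ℝ) (p : Fin m × Fin n × Fin m)
    (s : (Fin n → ℝ) × (Fin m → ℝ) × (Fin n → ℝ)) :
    (Fin n → ℝ) × (Fin m → ℝ) × (Fin n → ℝ) :=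
  let y := s.1 - ((A.mulVec s.1 p.1) / rowNorm2 A p.1) • (fun j => A p.1 j)
  let z := s.2.1 -
    ((Aᵀ.mulVec s.2.1 p.2.1 - c p.2.1 + y p.2.1) / colNorm2 A p.2.1) • (fun i => A i p.2.1)
  (y, z, s.2.2 -
    ((A.mulVec s.2.2 p.2.2 - b p.2.2 + z p.2.2) / rowNorm2 A p.2.2) • (fun j => A p.2.2 j))

/-- `μ` is the smallest nonzero (real) eigenvalue of the matrix `M`. -/
def IsSmallestNonzeroEigenvalue {n : ℕ} (M : Matrix (Fin n) (Fin n) ℝ) (μ : ℝ) : Prop :=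
  μ ≠ 0 ∧ (∃ v : Fin n → ℝ, v ≠ 0 ∧ M.mulVec v = μ • v) ∧
    ∀ t : ℝ, t ≠ 0 → (∃ v : Fin n → ℝ, v ≠ 0 ∧ M.mulVec v = t • v) → μ ≤ t

lemma sqnorm_eq_dotProduct {n : ℕ} (u : Fin n → ℝ) : sqnorm u = u ⬝ᵥ u := by
  simp [sqnorm, dotProduct, sq]

lemma sqnorm_nonneg {n : ℕ} (u : Fin n → ℝ) : 0 ≤ sqnorm u :=
  Finset.sum_nonneg fun _ _ => sq_nonneg _

lemma sqnorm_pos {n : ℕ} {u : Fin n → ℝ} (hu : u ≠ 0) : 0 < sqnorm u := by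
  obtain ⟨i, hi⟩ := Function.ne_iff.mp hu
  exact Finset.sum_pos' (fun _ _ => sq_nonneg _) ⟨i, Finset.mem_univ i, sq_pos_of_ne_zero hi⟩

lemma sqnorm_zero {n : ℕ} : sqnorm (0 : Fin n → ℝ) = 0 := by simp [sqnorm]

lemma frob2_eq_sum_rowNorm2 {m n : ℕ} (A : Matrix (Fin m) (Fin n) ℝ) :
    frob2 A = ∑ i, rowNorm2 A i := rfl

lemma frob2_transpose {m n : ℕ} (A : Matrix (Fin m) (Fin n) ℝ) : frob2 Aᵀ = frob2 A :=
  Finset.sum_comm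

lemma rowNorm2_pos {m n : ℕ} {A : Matrix (Fin m) (Fin n) ℝ} {i : Fin m}
    (h : (fun j => A i j) ≠ 0) : 0 < rowNorm2 A i :=
  sqnorm_pos h

lemma frob2_pos {m n : ℕ} {A : Matrix (Fin m) (Fin n) ℝ} (hA : A ≠ 0) : 0 < frob2 A := by
  obtain ⟨i, hi⟩ := Function.ne_iff.mp hA
  exact Finset.sum_pos' (fun _ _ => sqnorm_nonneg _) ⟨i, Finset.mem_univ i, rowNorm2_pos hi⟩

lemma sqnorm_mulVec_le {m n : ℕ} (A : Matrix (Fin m) (Fin n) ℝ) (v : Fin n → ℝ) :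
    sqnorm (A.mulVec v) ≤ frob2 A * sqnorm v := by
  rw [frob2, Finset.sum_mul]
  exact Finset.sum_le_sum fun i _ => Finset.sum_mul_sq_le_sq_mul_sq Finset.univ (A i) v

lemma sqnorm_mulVec {m n : ℕ} (A : Matrix (Fin m) (Fin n) ℝ) (v : Fin n → ℝ) :
    sqnorm (A.mulVec v) = v ⬝ᵥ (Aᵀ * A).mulVec v := by
  rw [sqnorm_eq_dotProduct, ← mulVec_mulVec, dotProduct_mulVec v, vecMul_transpose]

lemma IsSmallestNonzeroEigenvalue.le_frob2 {m n : ℕ} {A : Matrix (Fin m) (Fin n) ℝ} {μ : ℝ}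
    (hμ : IsSmallestNonzeroEigenvalue (Aᵀ * A) μ) : μ ≤ frob2 A := by
  obtain ⟨-, ⟨v, hv, h⟩, -⟩ := hμ
  have h1 := sqnorm_mulVec_le A v
  rw [sqnorm_mulVec, h, dotProduct_smul, ← sqnorm_eq_dotProduct, smul_eq_mul] at h1
  exact le_of_mul_le_mul_right h1 (sqnorm_pos hv)

/-- A lower bound on the nonzero eigenvalues of `AᵀA` bounds `Aᵀ` from below on the range of `A`. -/
lemma mul_sqnorm_mulVec_le {m n : ℕ} (A : Matrix (Fin m) (Fin n) ℝ) (μ : ℝ)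
    (h : ∀ t : ℝ, t ≠ 0 → (∃ v : Fin n → ℝ, v ≠ 0 ∧ (Aᵀ * A).mulVec v = t • v) → μ ≤ t)
    (u : Fin n → ℝ) : μ * sqnorm (A.mulVec u) ≤ sqnorm (Aᵀ.mulVec (A.mulVec u)) := by
  obtain ⟨U, d, hUU, hsp, hd⟩ : ∃ (U : Matrix (Fin n) (Fin n) ℝ) (d : Fin n → ℝ), Uᵀ * U = 1 ∧
      Aᵀ * A = U * diagonal d * Uᵀ ∧ ∀ i, 0 ≤ d i ∧ (d i ≠ 0 → μ ≤ d i) := by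
    have hM : (Aᵀ * A).PosSemidef := by
      simpa using posSemidef_conjTranspose_mul_self A
    have hH := hM.isHermitian
    have hstar : star (hH.eigenvectorUnitary : Matrix (Fin n) (Fin n) ℝ) =
        (hH.eigenvectorUnitary : Matrix (Fin n) (Fin n) ℝ)ᵀ := by
      rw [star_eq_conjTranspose, conjTranspose_eq_transpose_of_trivial]
    refine ⟨hH.eigenvectorUnitary, hH.eigenvalues, ?_, ?_, fun i => ⟨hM.eigenvalues_nonneg i,
      fun hz => h _ hz ⟨_, by simpa using hH.eigenvectorBasis.toBasis.ne_zero i,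
        hH.mulVec_eigenvectorBasis i⟩⟩⟩
    · rw [← hstar]
      exact Unitary.coe_star_mul_self hH.eigenvectorUnitary
    · rw [← hstar]
      simpa using hH.spectral_theorem
  have hdiag (f : Fin n → ℝ) :
      u ⬝ᵥ (U * diagonal f * Uᵀ).mulVec u = ∑ i, f i * Uᵀ.mulVec u i ^ 2 := by
    rw [← mulVec_mulVec, ← mulVec_mulVec, dotProduct_mulVec u, ← mulVec_transpose]
    simp only [dotProduct, mulVec_diagonal]
    exact Finset.sum_congr rfl fun i _ => by ring
  have hsq : (Aᵀ * A)ᵀ * (Aᵀ * A) = U * diagonal (fun i => d i ^ 2) * Uᵀ := by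
    have hsymm : (Aᵀ * A)ᵀ = Aᵀ * A := by simp
    calc (Aᵀ * A)ᵀ * (Aᵀ * A) = U * diagonal d * (Uᵀ * U) * diagonal d * Uᵀ := by
          rw [hsymm, hsp]
          simp only [Matrix.mul_assoc]
      _ = U * diagonal (fun i => d i ^ 2) * Uᵀ := by
          rw [hUU, Matrix.mul_one, Matrix.mul_assoc U, diagonal_mul_diagonal]
          simp only [sq]
  rw [mulVec_mulVec, sqnorm_mulVec, sqnorm_mulVec, hsq, hsp, hdiag, hdiag, Finset.mul_sum]
  refine Finset.sum_le_sum fun i _ => ?_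
  rw [← mul_assoc]
  refine mul_le_mul_of_nonneg_right ?_ (sq_nonneg _)
  obtain ⟨h0, hle⟩ := hd i
  by_cases hz : d i = 0
  · simp [hz]
  · nlinarith [hle hz]

lemma IsSmallestNonzeroEigenvalue.mul_sqnorm_le_of_mem_range {m n : ℕ}
    {A : Matrix (Fin m) (Fin n) ℝ} {μ : ℝ} (hμ : IsSmallestNonzeroEigenvalue (Aᵀ * A) μ)
    {f : Fin m → ℝ} (hf : f ∈ Set.range A.mulVec) : μ * sqnorm f ≤ sqnorm (Aᵀ.mulVec f) := by
  obtain ⟨u, rfl⟩ := hf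
  exact mul_sqnorm_mulVec_le A μ hμ.2.2 u

lemma IsSmallestNonzeroEigenvalue.mul_sqnorm_le_of_mem_range_transpose {m n : ℕ}
    {A : Matrix (Fin m) (Fin n) ℝ} {μ : ℝ} (hμ : IsSmallestNonzeroEigenvalue (Aᵀ * A) μ)
    {g : Fin n → ℝ} (hg : g ∈ Set.range Aᵀ.mulVec) : μ * sqnorm g ≤ sqnorm (A.mulVec g) := by
  obtain ⟨u, rfl⟩ := hg
  refine mul_sqnorm_mulVec_le Aᵀ μ (fun t ht ⟨v, hv, hvt⟩ => hμ.2.2 t ht ⟨Aᵀ.mulVec v, ?_, ?_⟩) u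
  · intro h0
    rw [transpose_transpose, ← mulVec_mulVec, h0, mulVec_zero] at hvt
    exact smul_ne_zero ht hv hvt.symm
  · rw [transpose_transpose] at hvt
    rw [← mulVec_mulVec, mulVec_mulVec v A, hvt, mulVec_smul]

lemma sub_smul_row_mem_range {m n : ℕ} {A : Matrix (Fin m) (Fin n) ℝ} {g : Fin n → ℝ}
    (hg : g ∈ Set.range Aᵀ.mulVec) (a : ℝ) (i : Fin m) :
    g - a • (fun j => A i j) ∈ Set.range Aᵀ.mulVec := by
  obtain ⟨u, rfl⟩ := hg
  refine ⟨u - a • Pi.single i 1, ?_⟩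
  rw [mulVec_sub, mulVec_smul, mulVec_single_one]
  rfl

/-- The squared error after a Kaczmarz step for the row `w` with right-hand side perturbed
by `h`. -/
lemma sqnorm_mul_sqnorm_sub_smul {n : ℕ} (v w : Fin n → ℝ) (h : ℝ) (hw : w ≠ 0) :
    sqnorm w * sqnorm (v - ((w ⬝ᵥ v + h) / sqnorm w) • w) =
      sqnorm w * sqnorm v - (w ⬝ᵥ v) ^ 2 + h ^ 2 := by
  have hr : sqnorm w ≠ 0 := (sqnorm_pos hw).ne'
  have : sqnorm (v - ((w ⬝ᵥ v + h) / sqnorm w) • w) =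
      sqnorm v - 2 * ((w ⬝ᵥ v + h) / sqnorm w) * (w ⬝ᵥ v) +
        ((w ⬝ᵥ v + h) / sqnorm w) ^ 2 * sqnorm w := by
    simp only [sqnorm_eq_dotProduct, sub_dotProduct, dotProduct_sub, smul_dotProduct,
      dotProduct_smul, smul_eq_mul, dotProduct_comm v w]
    ring
  rw [this]
  field_simp
  ring

/-- Expected error bound for one perturbed randomized Kaczmarz step. -/
lemma sum_rowNorm2_mul_kaczmarz_le {m n : ℕ} {A : Matrix (Fin m) (Fin n) ℝ}
    (hF : 0 < frob2 A) (hrows : ∀ i, (fun j => A i j) ≠ 0) {μ : ℝ} {v : Fin n → ℝ}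
    (hv : μ * sqnorm v ≤ sqnorm (A.mulVec v)) (h : Fin m → ℝ) (a : ℝ) {γ : ℝ} (hγ : 0 ≤ γ) :
    ∑ i, rowNorm2 A i / frob2 A *
        (a + γ * sqnorm (v - ((A.mulVec v i + h i) / rowNorm2 A i) • (fun j => A i j))) ≤
      a + γ * ((1 - μ / frob2 A) * sqnorm v + sqnorm h / frob2 A) := by
  have key : ∑ i, rowNorm2 A i / frob2 A *
        (a + γ * sqnorm (v - ((A.mulVec v i + h i) / rowNorm2 A i) • (fun j => A i j))) =
      a + γ * (sqnorm v + (sqnorm h - sqnorm (A.mulVec v)) / frob2 A) := by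
    have hi (i : Fin m) : rowNorm2 A i / frob2 A *
        (a + γ * sqnorm (v - ((A.mulVec v i + h i) / rowNorm2 A i) • (fun j => A i j))) =
        (rowNorm2 A i * (a + γ * sqnorm v) + γ * (h i ^ 2 - A.mulVec v i ^ 2)) / frob2 A := by
      have h1 := sqnorm_mul_sqnorm_sub_smul v (fun j => A i j) (h i) (hrows i)
      change rowNorm2 A i * sqnorm (v - ((A.mulVec v i + h i) / rowNorm2 A i) • (fun j => A i j)) =
        rowNorm2 A i * sqnorm v - A.mulVec v i ^ 2 + h i ^ 2 at h1
      rw [div_mul_eq_mul_div]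
      congr 1
      linear_combination γ * h1
    simp_rw [hi]
    rw [← Finset.sum_div, Finset.sum_add_distrib, ← Finset.sum_mul, ← Finset.mul_sum,
      Finset.sum_sub_distrib, ← frob2_eq_sum_rowNorm2]
    change (_ + γ * (sqnorm h - sqnorm (A.mulVec v))) / _ = _
    field_simp
    ring
  rw [key]
  have : μ / frob2 A * sqnorm v ≤ sqnorm (A.mulVec v) / frob2 A := by
    rw [div_mul_eq_mul_div]
    gcongr
  refine add_le_add_right (mul_le_mul_of_nonneg_left ?_ hγ) a
  rw [sub_div]
  linarith

section Step

variable {m n : ℕ} {A : Matrix (Fin m) (Fin n) ℝ} {b : Fin m → ℝ} {c : Fin n → ℝ}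
  {ys : Fin n → ℝ} {zs : Fin m → ℝ} {xs : Fin n → ℝ}

lemma rtkStep_fst_sub (hys : A.mulVec ys = 0) (q : Fin m × Fin n × Fin m)
    (s : (Fin n → ℝ) × (Fin m → ℝ) × (Fin n → ℝ)) :
    (rtkStep A b c q s).1 - ys = (s.1 - ys) -
      ((A.mulVec (s.1 - ys) q.1 + (0 : Fin m → ℝ) q.1) / rowNorm2 A q.1) •
        (fun j => A q.1 j) := by
  rw [mulVec_sub, hys, sub_zero, Pi.zero_apply, add_zero, rtkStep]
  exact sub_right_comm _ _ _

lemma rtkStep_snd_fst_sub (hzs : Aᵀ.mulVec zs = c - ys) (q : Fin m × Fin n × Fin m)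
    (s : (Fin n → ℝ) × (Fin m → ℝ) × (Fin n → ℝ)) :
    (rtkStep A b c q s).2.1 - zs = (s.2.1 - zs) -
      ((Aᵀ.mulVec (s.2.1 - zs) q.2.1 + ((rtkStep A b c q s).1 - ys) q.2.1) /
        rowNorm2 Aᵀ q.2.1) • (fun i => Aᵀ q.2.1 i) := by
  have : Aᵀ.mulVec (s.2.1 - zs) q.2.1 + ((rtkStep A b c q s).1 - ys) q.2.1 =
      Aᵀ.mulVec s.2.1 q.2.1 - c q.2.1 + (rtkStep A b c q s).1 q.2.1 := by
    rw [mulVec_sub, hzs]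
    simp only [Pi.sub_apply]
    ring
  rw [this]
  exact sub_right_comm _ _ _

lemma rtkStep_snd_snd_sub (hxs : A.mulVec xs = b - zs) (q : Fin m × Fin n × Fin m)
    (s : (Fin n → ℝ) × (Fin m → ℝ) × (Fin n → ℝ)) :
    (rtkStep A b c q s).2.2 - xs = (s.2.2 - xs) -
      ((A.mulVec (s.2.2 - xs) q.2.2 + ((rtkStep A b c q s).2.1 - zs) q.2.2) /
        rowNorm2 A q.2.2) • (fun j => A q.2.2 j) := by
  have : A.mulVec (s.2.2 - xs) q.2.2 + ((rtkStep A b c q s).2.1 - zs) q.2.2 =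
      A.mulVec s.2.2 q.2.2 - b q.2.2 + (rtkStep A b c q s).2.1 q.2.2 := by
    rw [mulVec_sub, hxs]
    simp only [Pi.sub_apply]
    ring
  rw [this]
  exact sub_right_comm _ _ _

/-- Expected decrease of a weighted sum of the three squared errors in one RTK step. -/
lemma sum_weight_mul_rtkStep_le (hF : 0 < frob2 A) (hrows : ∀ i, (fun j => A i j) ≠ 0)
    (hcols : ∀ j, (fun i => A i j) ≠ 0) {μ : ℝ} (hμ : IsSmallestNonzeroEigenvalue (Aᵀ * A) μ)
    (hys : A.mulVec ys = 0) (hzs : Aᵀ.mulVec zs = c - ys) (hxs : A.mulVec xs = b - zs)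
    (s : (Fin n → ℝ) × (Fin m → ℝ) × (Fin n → ℝ))
    (hy : s.1 - ys ∈ Set.range (Aᵀ.mulVec)) (hz : s.2.1 - zs ∈ Set.range A.mulVec)
    (hx : s.2.2 - xs ∈ Set.range (Aᵀ.mulVec))
    {α β γ : ℝ} (hα : 0 ≤ α) (hβ : 0 ≤ β) (hγ : 0 ≤ γ) :
    ∑ q : Fin m × Fin n × Fin m,
        (rowNorm2 A q.1 / frob2 A) * ((colNorm2 A q.2.1 / frob2 A) *
          (rowNorm2 A q.2.2 / frob2 A)) *
          (α * sqnorm ((rtkStep A b c q s).1 - ys) + β * sqnorm ((rtkStep A b c q s).2.1 - zs) +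
            γ * sqnorm ((rtkStep A b c q s).2.2 - xs)) ≤
      (1 - μ / frob2 A) * ((α + (β + γ / frob2 A) / frob2 A) * sqnorm (s.1 - ys) +
        (β + γ / frob2 A) * sqnorm (s.2.1 - zs) + γ * sqnorm (s.2.2 - xs)) := by
  have hFt : 0 < frob2 Aᵀ := by rwa [frob2_transpose]
  have hβ' : 0 ≤ β + γ / frob2 A := by positivity
  have hα' : 0 ≤ α + (β + γ / frob2 A) / frob2 A := by positivity
  have hgv := hμ.mul_sqnorm_le_of_mem_range_transpose hy
  have hfv := hμ.mul_sqnorm_le_of_mem_range hz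
  have hev := hμ.mul_sqnorm_le_of_mem_range_transpose hx
  set g := s.1 - ys
  set f := s.2.1 - zs
  set e := s.2.2 - xs
  set g' : Fin m → Fin n → ℝ := fun l =>
    g - ((A.mulVec g l + (0 : Fin m → ℝ) l) / rowNorm2 A l) • (fun j => A l j)
  set f' : Fin m → Fin n → Fin m → ℝ := fun l j =>
    f - ((Aᵀ.mulVec f j + g' l j) / rowNorm2 Aᵀ j) • (fun i => Aᵀ j i)
  set e' : Fin m → Fin n → Fin m → Fin n → ℝ := fun l j i =>
    e - ((A.mulVec e i + f' l j i) / rowNorm2 A i) • (fun j => A i j)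
  have hqg (q) : (rtkStep A b c q s).1 - ys = g' q.1 := rtkStep_fst_sub hys q s
  have hqf (q) : (rtkStep A b c q s).2.1 - zs = f' q.1 q.2.1 := by
    rw [rtkStep_snd_fst_sub hzs, hqg]
  have hqe (q) : (rtkStep A b c q s).2.2 - xs = e' q.1 q.2.1 q.2.2 := by
    rw [rtkStep_snd_snd_sub hxs, hqf]
  simp_rw [hqg, hqf, hqe, Fintype.sum_prod_type, mul_assoc, ← Finset.mul_sum]
  set ρ := 1 - μ / frob2 A with hρ
  have hw (i) : 0 ≤ rowNorm2 A i / frob2 A := div_nonneg (sqnorm_nonneg _) hF.le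
  have hwc (j) : 0 ≤ colNorm2 A j / frob2 A := div_nonneg (sqnorm_nonneg _) hF.le
  calc
    _ ≤ ∑ l, rowNorm2 A l / frob2 A * ∑ j, colNorm2 A j / frob2 A *
        ((α * sqnorm (g' l) + γ * ρ * sqnorm e) + (β + γ / frob2 A) * sqnorm (f' l j)) := by
      gcongr with l _ j _
      · exact hw l
      · exact hwc j
      · refine (sum_rowNorm2_mul_kaczmarz_le hF hrows hev (f' l j) _ hγ).trans_eq ?_
        ring
    _ ≤ ∑ l, rowNorm2 A l / frob2 A *
        ((γ * ρ * sqnorm e + (β + γ / frob2 A) * ρ * sqnorm f) +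
          (α + (β + γ / frob2 A) / frob2 A) * sqnorm (g' l)) := by
      gcongr with l _
      · exact hw l
      · have := sum_rowNorm2_mul_kaczmarz_le hFt hcols hfv (g' l)
          (α * sqnorm (g' l) + γ * ρ * sqnorm e) hβ'
        rw [frob2_transpose] at this
        refine this.trans_eq ?_
        ring
    _ ≤ _ := by
      refine (sum_rowNorm2_mul_kaczmarz_le hF hrows hgv 0 _ hα').trans_eq ?_
      rw [sqnorm_zero]
      ring

/-- The RTK convergence estimate, for an arbitrary number of steps and initial state. -/
lemma sum_weight_mul_rtk_le (hF : 0 < frob2 A) (hrows : ∀ i, (fun j => A i j) ≠ 0)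
    (hcols : ∀ j, (fun i => A i j) ≠ 0) {μ : ℝ} (hμ : IsSmallestNonzeroEigenvalue (Aᵀ * A) μ)
    (hys : A.mulVec ys = 0) (hzs : Aᵀ.mulVec zs = c - ys) (hxs : A.mulVec xs = b - zs) (k : ℕ)
    (s : (Fin n → ℝ) × (Fin m → ℝ) × (Fin n → ℝ))
    (hy : s.1 - ys ∈ Set.range (Aᵀ.mulVec)) (hz : s.2.1 - zs ∈ Set.range A.mulVec)
    (hx : s.2.2 - xs ∈ Set.range (Aᵀ.mulVec)) :
    ∑ p : Fin k → Fin m × Fin n × Fin m,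
        (∏ t, (rowNorm2 A (p t).1 / frob2 A) * ((colNorm2 A (p t).2.1 / frob2 A) *
            (rowNorm2 A (p t).2.2 / frob2 A))) *
          sqnorm (((List.ofFn p).foldl (fun s q => rtkStep A b c q s) s).2.2 - xs)
      ≤ (k : ℝ) * ((k : ℝ) + 1) * (1 - μ / frob2 A) ^ k / (2 * (frob2 A) ^ 2) * sqnorm (s.1 - ys)
        + (k : ℝ) * (1 - μ / frob2 A) ^ k / frob2 A * sqnorm (s.2.1 - zs)
        + (1 - μ / frob2 A) ^ k * sqnorm (s.2.2 - xs) := by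
  have hρ : 0 ≤ 1 - μ / frob2 A := sub_nonneg.mpr ((div_le_one hF).mpr hμ.le_frob2)
  induction k generalizing s with
  | zero => simp
  | succ k ih =>
    rw [← (Fin.consEquiv fun _ => Fin m × Fin n × Fin m).sum_comp, Fintype.sum_prod_type]
    simp only [Fin.consEquiv_apply, Fin.prod_univ_succ, Fin.cons_zero, Fin.cons_succ,
      List.ofFn_succ, List.foldl_cons]
    refine (Finset.sum_le_sum fun q _ => ?_).trans
      ((sum_weight_mul_rtkStep_le hF hrows hcols hμ hys hzs hxs s hy hz hx
        (α := (k : ℝ) * ((k : ℝ) + 1) * (1 - μ / frob2 A) ^ k / (2 * (frob2 A) ^ 2))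
        (β := (k : ℝ) * (1 - μ / frob2 A) ^ k / frob2 A) (γ := (1 - μ / frob2 A) ^ k)
        (by positivity) (by positivity) (by positivity)).trans_eq ?_)
    · simp only [mul_assoc (rowNorm2 A q.1 / frob2 A * (colNorm2 A q.2.1 / frob2 A *
        (rowNorm2 A q.2.2 / frob2 A))), ← Finset.mul_sum]
      have hw (i) : 0 ≤ rowNorm2 A i / frob2 A := div_nonneg (sqnorm_nonneg _) hF.le
      have hwc (j) : 0 ≤ colNorm2 A j / frob2 A := div_nonneg (sqnorm_nonneg _) hF.le
      refine mul_le_mul_of_nonneg_left (ih _ ?_ ?_ ?_)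
        (mul_nonneg (hw _) (mul_nonneg (hwc _) (hw _)))
      · rw [rtkStep_fst_sub hys]
        exact sub_smul_row_mem_range hy _ _
      · rw [rtkStep_snd_fst_sub hzs]
        exact sub_smul_row_mem_range (A := Aᵀ) hz _ _
      · rw [rtkStep_snd_snd_sub hxs]
        exact sub_smul_row_mem_range hx _ _
    · generalize 1 - μ / frob2 A = ρ
      push_cast
      field_simp
      ring

end Step

/-- Convergence of the randomized triple Kaczmarz algorithm:
`E[‖x^k − x*‖₂²] ≤ (k(k+1)ρ^k/(2‖A‖_F⁴))‖y⁰ − y*‖₂² + (kρ^k/‖A‖_F²)‖z⁰ − z*‖₂²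
 + ρ^k‖x⁰ − x*‖₂²` with `ρ = 1 − μ/‖A‖_F²`. -/
theorem stmt11 {m n : ℕ} (A : Matrix (Fin m) (Fin n) ℝ) (hA : A ≠ 0)
    (hrows : ∀ i, (fun j => A i j) ≠ 0) (hcols : ∀ j, (fun i => A i j) ≠ 0)
    (μ : ℝ) (hμ : IsSmallestNonzeroEigenvalue (Aᵀ * A) μ)
    (b : Fin m → ℝ) (c : Fin n → ℝ) (hc : c ∉ Set.range (Aᵀ.mulVec))
    (y0 : Fin n → ℝ) (hy0 : y0 - c ∈ Set.range (Aᵀ.mulVec))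
    (z0 : Fin m → ℝ) (hz0 : z0 - b ∈ Set.range A.mulVec) (x0 : Fin n → ℝ)
    (ys : Fin n → ℝ) (hys : A.mulVec ys = 0) (hy0ys : y0 - ys ∈ Set.range (Aᵀ.mulVec))
    (zs : Fin m → ℝ) (hzs : Aᵀ.mulVec zs = c - ys) (hz0zs : z0 - zs ∈ Set.range A.mulVec)
    (xs : Fin n → ℝ) (hxs : A.mulVec xs = b - zs) (hx0xs : x0 - xs ∈ Set.range (Aᵀ.mulVec))
    (k : ℕ) (hk : 1 ≤ k) :
    ∑ p : Fin k → Fin m × Fin n × Fin m,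
        (∏ t, (rowNorm2 A (p t).1 / frob2 A) * ((colNorm2 A (p t).2.1 / frob2 A) *
            (rowNorm2 A (p t).2.2 / frob2 A))) *
          sqnorm (((List.ofFn p).foldl (fun s q => rtkStep A b c q s) (y0, z0, x0)).2.2 - xs)
      ≤ (k : ℝ) * ((k : ℝ) + 1) * (1 - μ / frob2 A) ^ k / (2 * (frob2 A) ^ 2) *
            sqnorm (y0 - ys)
        + (k : ℝ) * (1 - μ / frob2 A) ^ k / frob2 A * sqnorm (z0 - zs)
        + (1 - μ / frob2 A) ^ k * sqnorm (x0 - xs) := by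
  exact sum_weight_mul_rtk_le (frob2_pos hA) hrows hcols hμ hys hzs hxs k (y0, z0, x0)
    hy0ys hz0zs hx0xs
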